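/- arXiv:math/0601021 — 3 statements merged into one kernel-verified Lean document; each statement's English description precedes it below -/
import Mathlib

section
/- Let N, K, b be integers with N ≥ 1, K ≥ 0, b ≥ 1 and b < 2N, and let S = {−(N+Kb), …, −(N+b), −N} ∪ {N, N+b, …, N+Kb} = {λ ∈ ℤ : |λ| = N + jb for some 0 ≤ j ≤ K}. Then the supremum, over all real trigonometric polynomials f with spectrum contained in S and over all intervals I ⊆ [0,1] on which f has no zero, of the length |I|, equals (K+1)/(bK+2N). -/
open scoped BigOperators

/-- The symmetric (sine) form of the Gaussian binomial coefficient. -/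
noncomputable def sineBinom (θ : ℝ) (n k : ℕ) : ℝ :=
  (∏ i ∈ Finset.range k, Real.sin (((n : ℝ) - i) * θ)) /
    ∏ i ∈ Finset.range k, Real.sin (((i : ℝ) + 1) * θ)

theorem sineBinom_zero_right (θ : ℝ) (n : ℕ) : sineBinom θ n 0 = 1 := by
  simp [sineBinom]

theorem sineBinom_self_succ (θ : ℝ) (n : ℕ) : sineBinom θ n (n + 1) = 0 := by
  simp [sineBinom, Finset.prod_range_succ]

theorem sineBinom_succ_right (θ : ℝ) (n k : ℕ) :
    sineBinom θ n (k + 1) =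
      sineBinom θ n k * (Real.sin (((n : ℝ) - k) * θ) / Real.sin (((k : ℝ) + 1) * θ)) := by
  simp only [sineBinom, Finset.prod_range_succ]
  rw [mul_div_mul_comm]

theorem sineBinom_succ_succ (θ : ℝ) (n k : ℕ) :
    sineBinom θ (n + 1) (k + 1) =
      sineBinom θ n k * (Real.sin (((n : ℝ) + 1) * θ) / Real.sin (((k : ℝ) + 1) * θ)) := by
  simp only [sineBinom]
  rw [Finset.prod_range_succ', Finset.prod_range_succ _ k, mul_div_mul_comm]
  simp

theorem sineBinom_pos {θ : ℝ} {n : ℕ} (h0 : 0 < θ) (h1 : n * θ < Real.pi) {k : ℕ}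
    (hk : k ≤ n) : 0 < sineBinom θ n k := by
  refine div_pos (Finset.prod_pos fun i hi => ?_) (Finset.prod_pos fun i hi => ?_)
  all_goals
    have hi' : (i : ℝ) + 1 ≤ n := by
      have := Finset.mem_range.1 hi
      exact_mod_cast (by omega : i + 1 ≤ n)
    have h2 : (0 : ℝ) ≤ i := Nat.cast_nonneg i
    apply Real.sin_pos_of_pos_of_lt_pi
    · apply mul_pos _ h0
      linarith
    · nlinarith

theorem sin_add_eq_exp_mul_sin (a c : ℝ) :
    (Real.sin (a + c) : ℂ) = Complex.exp (c * Complex.I) * Real.sin a +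
      Complex.exp (-(a * Complex.I)) * Real.sin c := by
  rw [← neg_mul, Complex.exp_mul_I, Complex.exp_mul_I, Real.sin_add]
  simp
  ring

theorem sineBinom_pascal {θ : ℝ} {n k : ℕ} (h : Real.sin (((k : ℝ) + 1) * θ) ≠ 0) :
    (sineBinom θ (n + 1) (k + 1) : ℂ) =
      sineBinom θ n (k + 1) * Complex.exp (θ * Complex.I) ^ (k + 1) +
      sineBinom θ n k * (Complex.exp (θ * Complex.I) ^ k *
        Complex.exp (-(n * θ * Complex.I))) := by
  have key := sin_add_eq_exp_mul_sin (((n : ℝ) - k) * θ) (((k : ℝ) + 1) * θ)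
  have e : ((n : ℝ) - k) * θ + ((k : ℝ) + 1) * θ = ((n : ℝ) + 1) * θ := by ring
  rw [e] at key
  have h' : (Real.sin (((k : ℝ) + 1) * θ) : ℂ) ≠ 0 := by exact_mod_cast h
  rw [sineBinom_succ_succ, sineBinom_succ_right, ← Complex.exp_nat_mul, ← Complex.exp_nat_mul,
    ← Complex.exp_add]
  rw [Complex.ofReal_mul, Complex.ofReal_mul, Complex.ofReal_div, Complex.ofReal_div, key]
  have e1 : ((k + 1 : ℕ) : ℂ) * (θ * Complex.I) = ((((k : ℝ) + 1) * θ : ℝ) : ℂ) * Complex.I := by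
    push_cast; ring
  have e2 : (k : ℂ) * (θ * Complex.I) + -(n * θ * Complex.I)
      = -(((((n : ℝ) - k) * θ : ℝ) : ℂ) * Complex.I) := by
    push_cast; ring
  rw [e1, e2]
  field_simp

/-- The `q`-binomial theorem for `q` on the unit circle, in symmetric form. -/
theorem sum_sineBinom_mul_pow {θ : ℝ} (h0 : 0 < θ) (n : ℕ) (h1 : n * θ < Real.pi) (z : ℂ) :
    ∑ k ∈ Finset.range (n + 1), (sineBinom θ n k : ℂ) * z ^ k =
      ∏ j ∈ Finset.range n,
        (1 + z * Complex.exp ((2 * (j : ℂ) - ((n : ℂ) - 1)) * θ * Complex.I)) := by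
  induction n generalizing z with
  | zero => simp [sineBinom_zero_right]
  | succ n ih =>
    have hn : n * θ < Real.pi := by push_cast at h1; linarith
    have ih' := ih hn (z * Complex.exp (θ * Complex.I))
    have e : ∏ j ∈ Finset.range n, (1 + z * Complex.exp (θ * Complex.I) *
          Complex.exp ((2 * (j : ℂ) - ((n : ℂ) - 1)) * θ * Complex.I)) =
        ∏ j ∈ Finset.range n, (1 + z *
          Complex.exp ((2 * ((j + 1 : ℕ) : ℂ) - (((n + 1 : ℕ) : ℂ) - 1)) * θ * Complex.I)) := by
      refine Finset.prod_congr rfl fun j _ => ?_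
      rw [mul_assoc z, ← Complex.exp_add]
      congr 3
      push_cast; ring
    rw [Finset.prod_range_succ', ← e, ← ih']
    have e0 : (2 * ((0 : ℕ) : ℂ) - (((n + 1 : ℕ) : ℂ) - 1)) * θ * Complex.I
        = -(n * θ * Complex.I) := by push_cast; ring
    rw [e0, Finset.sum_range_succ', mul_add, mul_one]
    have hpas : ∀ k ∈ Finset.range (n + 1), (sineBinom θ (n + 1) (k + 1) : ℂ) * z ^ (k + 1) =
        sineBinom θ n (k + 1) * (z * Complex.exp (θ * Complex.I)) ^ (k + 1) +
        sineBinom θ n k * (z * Complex.exp (θ * Complex.I)) ^ k *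
          (z * Complex.exp (-(n * θ * Complex.I))) := by
      intro k hk
      have hk' : (k : ℝ) + 1 ≤ (n + 1 : ℕ) := by
        have := Finset.mem_range.1 hk
        exact_mod_cast (by omega : k + 1 ≤ n + 1)
      rw [sineBinom_pascal]
      · ring
      · apply ne_of_gt
        apply Real.sin_pos_of_pos_of_lt_pi
        · positivity
        · nlinarith
    rw [Finset.sum_congr rfl hpas, Finset.sum_add_distrib, ← Finset.sum_mul,
      Finset.sum_range_succ (fun k => (sineBinom θ n (k + 1) : ℂ) * _), sineBinom_self_succ]
    rw [Finset.sum_range_succ' (fun k => (sineBinom θ n k : ℂ) * _)]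
    simp only [sineBinom_zero_right]
    push_cast
    ring

theorem ContinuousOn.pos_or_neg_of_ne_zero {g : ℝ → ℝ} {u v : ℝ}
    (hg : ContinuousOn g (Set.Icc u v)) (h : ∀ t ∈ Set.Icc u v, g t ≠ 0) :
    (∀ t ∈ Set.Icc u v, 0 < g t) ∨ (∀ t ∈ Set.Icc u v, g t < 0) := by
  by_contra! H
  obtain ⟨⟨a, ha, ha'⟩, b, hb, hb'⟩ := H
  obtain ⟨t, ht, h0⟩ := isPreconnected_Icc.intermediate_value ha hb hg ⟨ha', hb'⟩
  exact h t ht h0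

theorem prod_sin_eq_sum_exp (b : ℝ) (K : ℕ) (x : ℕ → ℝ) : ∃ d : ℕ → ℂ, ∀ t : ℝ,
    ((∏ k ∈ Finset.range K, Real.sin (Real.pi * b * (x k - t)) : ℝ) : ℂ) =
      ∑ j ∈ Finset.range (K + 1),
        d j * Complex.exp (Real.pi * Complex.I * b * (2 * (j : ℂ) - K) * t) := by
  open Polynomial in
  let P : ℂ[X] := ∏ k ∈ Finset.range K,
    (C (-(Complex.exp (-(Real.pi * b * x k * Complex.I)) / (2 * Complex.I))) * X +
      C (Complex.exp (Real.pi * b * x k * Complex.I) / (2 * Complex.I)))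
  have hP : P.natDegree < K + 1 := by
    refine Nat.lt_succ_of_le ((Polynomial.natDegree_prod_le _ _).trans ?_)
    refine (Finset.sum_le_sum fun k _ => Polynomial.natDegree_linear_le).trans ?_
    simp
  refine ⟨P.coeff, fun t => ?_⟩
  have h1 : ∑ j ∈ Finset.range (K + 1),
        P.coeff j * Complex.exp (Real.pi * Complex.I * b * (2 * (j : ℂ) - K) * t) =
      P.eval (Complex.exp (2 * (Real.pi * Complex.I * b * t))) *
        Complex.exp (-(Real.pi * Complex.I * b * t)) ^ K := by
    rw [Polynomial.eval_eq_sum_range' hP, Finset.sum_mul]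
    refine Finset.sum_congr rfl fun j _ => ?_
    rw [mul_assoc (P.coeff j), ← Complex.exp_nat_mul, ← Complex.exp_nat_mul, ← Complex.exp_add]
    congr 2
    ring
  rw [h1, Polynomial.eval_prod]
  conv_rhs => rw [← Finset.card_range K, ← Finset.prod_const, Finset.card_range]
  rw [← Finset.prod_mul_distrib, Complex.ofReal_prod]
  refine Finset.prod_congr rfl fun k _ => ?_
  simp only [Polynomial.eval_add, Polynomial.eval_mul, Polynomial.eval_C, Polynomial.eval_X]
  have e1 : Complex.exp (((Real.pi * b * (x k - t) : ℝ) : ℂ) * Complex.I) =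
      Complex.exp (Real.pi * b * x k * Complex.I) *
        Complex.exp (-(Real.pi * Complex.I * b * t)) := by
    rw [← Complex.exp_add]; congr 1; push_cast; ring
  have e2 : Complex.exp (-((Real.pi * b * (x k - t) : ℝ) : ℂ) * Complex.I) =
      Complex.exp (-(Real.pi * b * x k * Complex.I)) *
        Complex.exp (2 * (Real.pi * Complex.I * b * t)) *
        Complex.exp (-(Real.pi * Complex.I * b * t)) := by
    rw [← Complex.exp_add, ← Complex.exp_add]; congr 1; push_cast; ring
  rw [Complex.ofReal_sin, Complex.sin, e1, e2]
  field_simp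
  rw [Complex.I_sq]
  ring

theorem exists_sum_exp_eq_sin_mul_prod_sin {N K b : ℕ} {S : Finset ℤ}
    (hS : ∀ lam : ℤ, lam ∈ S ↔ ∃ j : ℕ, j ≤ K ∧ |lam| = (N : ℤ) + j * b)
    (φ : ℝ) (x : ℕ → ℝ) : ∃ c : ℤ → ℂ, ∀ t : ℝ,
      ∑ lam ∈ S, c lam * Complex.exp (2 * Real.pi * Complex.I * (lam : ℂ) * (t : ℂ)) =
        ((Real.sin (Real.pi * (b * K + 2 * N) * t + φ) *
          ∏ k ∈ Finset.range K, Real.sin (Real.pi * b * (x k - t)) : ℝ) : ℂ) := by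
  obtain ⟨d, hd⟩ := prod_sin_eq_sum_exp b K x
  let e : ℤ → ℝ → ℂ := fun lam t => Complex.exp (2 * Real.pi * Complex.I * (lam : ℂ) * (t : ℂ))
  have hmem : ∑ j ∈ Finset.range (K + 1),
      ((d j * (Complex.I / 2) * Complex.exp (-(φ * Complex.I))) •
          e (-((N : ℤ) + ((K - j : ℕ) : ℤ) * b)) +
        (-(d j * (Complex.I / 2) * Complex.exp (φ * Complex.I))) • e ((N : ℤ) + j * b)) ∈
      Submodule.span ℂ (e '' (S : Set ℤ)) := by
    refine Submodule.sum_mem _ fun j hj => Submodule.add_mem _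
      (Submodule.smul_mem _ _ (Submodule.subset_span ⟨_, ?_, rfl⟩))
      (Submodule.smul_mem _ _ (Submodule.subset_span ⟨_, ?_, rfl⟩))
    · refine (hS _).2 ⟨K - j, Nat.sub_le _ _, ?_⟩
      rw [abs_neg, abs_of_nonneg (by positivity)]
    · refine (hS _).2 ⟨j, Nat.lt_succ_iff.1 (Finset.mem_range.1 hj), ?_⟩
      rw [abs_of_nonneg (by positivity)]
  obtain ⟨c, hc⟩ := (Submodule.mem_span_image_finset_iff_exists_fun' ℂ).1 hmem
  refine ⟨c, fun t => ?_⟩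
  have hct := congrFun hc t
  simp only [Finset.sum_apply, Pi.smul_apply, Pi.add_apply, smul_eq_mul, e] at hct
  rw [hct, Complex.ofReal_mul, hd, Finset.mul_sum]
  refine Finset.sum_congr rfl fun j hj => ?_
  have hjK : j ≤ K := Nat.lt_succ_iff.1 (Finset.mem_range.1 hj)
  have e1 : Complex.exp (2 * Real.pi * Complex.I *
        ((-((N : ℤ) + ((K - j : ℕ) : ℤ) * b) : ℤ) : ℂ) * t) =
      Complex.exp (-(Real.pi * (b * K + 2 * N) * t * Complex.I)) *
        Complex.exp (Real.pi * Complex.I * (b : ℝ) * (2 * (j : ℂ) - K) * t) := by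
    rw [← Complex.exp_add]; congr 1; push_cast [Nat.cast_sub hjK]; ring
  have e2 : Complex.exp (2 * Real.pi * Complex.I * (((N : ℤ) + j * b : ℤ) : ℂ) * t) =
      Complex.exp (Real.pi * (b * K + 2 * N) * t * Complex.I) *
        Complex.exp (Real.pi * Complex.I * (b : ℝ) * (2 * (j : ℂ) - K) * t) := by
    rw [← Complex.exp_add]; congr 1; push_cast; ring
  have e3 : Complex.exp (((Real.pi * (b * K + 2 * N) * t + φ : ℝ) : ℂ) * Complex.I) =
      Complex.exp (Real.pi * (b * K + 2 * N) * t * Complex.I) *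
        Complex.exp (φ * Complex.I) := by
    rw [← Complex.exp_add]; congr 1; push_cast; ring
  have e4 : Complex.exp (-((Real.pi * (b * K + 2 * N) * t + φ : ℝ) : ℂ) * Complex.I) =
      Complex.exp (-(Real.pi * (b * K + 2 * N) * t * Complex.I)) *
        Complex.exp (-(φ * Complex.I)) := by
    rw [← Complex.exp_add]; congr 1; push_cast; ring
  rw [Complex.ofReal_sin, Complex.sin, e1, e2, e3, e4]
  ring

/-- A function nonnegative on `(0, (K + 1) / D)` whose zeros there are the multiples of `1 / D`. -/
noncomputable def sineProduct (D b : ℝ) (K : ℕ) (t : ℝ) : ℝ :=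
  Real.sin (Real.pi * D * t) *
    ∏ k ∈ Finset.range K, Real.sin (Real.pi * b * (((k : ℝ) + 1) / D - t))

theorem sineProduct_eq_zero {D b : ℝ} {K : ℕ} {t : ℝ} {m : ℕ} (h : D * t = m) :
    sineProduct D b K t = 0 := by
  rw [sineProduct, mul_assoc Real.pi, h, mul_comm Real.pi (m : ℝ), Real.sin_nat_mul_pi, zero_mul]

theorem sineProduct_pos {D b : ℝ} {K : ℕ} {t : ℝ} (hD : 0 < D) (hb : 0 < b)
    (hbD : b * (K + 1) ≤ D) (ht0 : 0 < t) (ht : D * t < K + 1) (hne : ∀ m : ℕ, D * t ≠ m) :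
    0 < sineProduct D b K t := by
  have hsin : ∀ y : ℝ, 0 < D * y → D * y < K + 1 → 0 < Real.sin (Real.pi * b * y) := by
    intro y hy0 hy
    have hy0' : 0 < y := pos_of_mul_pos_right hy0 hD.le
    refine Real.sin_pos_of_pos_of_lt_pi (by positivity) ?_
    have h1 : D * (b * y) < D * 1 := by nlinarith
    have h2 : b * y < 1 := lt_of_mul_lt_mul_left h1 hD.le
    nlinarith [Real.pi_pos]
  obtain ⟨m, hm⟩ : ∃ m : ℕ, m = ⌊D * t⌋₊ := ⟨_, rfl⟩
  have hDt : 0 ≤ D * t := by positivity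
  have hm1 : (m : ℝ) < D * t := lt_of_le_of_ne (hm ▸ Nat.floor_le hDt) (hne m).symm
  have hm2 : D * t < m + 1 := hm ▸ Nat.lt_floor_add_one _
  have hmK : m ≤ K := by
    have : (m : ℝ) < (K + 1 : ℕ) := by push_cast; linarith
    exact Nat.lt_succ_iff.1 (by exact_mod_cast this)
  obtain ⟨l, rfl⟩ := Nat.exists_eq_add_of_le hmK
  have hs : Real.sin (Real.pi * D * t) = (-1) ^ m * Real.sin (Real.pi * (D * t - m)) := by
    rw [← Real.sin_add_nat_mul_pi]; congr 1; ring
  have hmul : ∀ a y : ℝ, D * (a / D - y) = a - D * y := fun a y => by field_simp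
  have hp : ∏ k ∈ Finset.range m, Real.sin (Real.pi * b * (((k : ℝ) + 1) / D - t)) =
      (-1) ^ m * ∏ k ∈ Finset.range m, Real.sin (Real.pi * b * (t - ((k : ℝ) + 1) / D)) := by
    conv_rhs => rw [← Finset.card_range m, ← Finset.prod_const, Finset.card_range]
    rw [← Finset.prod_mul_distrib]
    refine Finset.prod_congr rfl fun k _ => ?_
    rw [neg_one_mul, ← Real.sin_neg]; congr 1; ring
  have hpos1 : 0 < ∏ k ∈ Finset.range m, Real.sin (Real.pi * b * (t - ((k : ℝ) + 1) / D)) := by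
    refine Finset.prod_pos fun k hk => hsin _ ?_ ?_
    all_goals
      have hk' : (k : ℝ) + 1 ≤ m := by exact_mod_cast Finset.mem_range.1 hk
      have h0 : (0 : ℝ) ≤ k := Nat.cast_nonneg k
      have := hmul (k + 1) t
      linarith
  have hpos2 : 0 < ∏ k ∈ Finset.range l,
      Real.sin (Real.pi * b * ((((m + k : ℕ) : ℝ) + 1) / D - t)) := by
    refine Finset.prod_pos fun k hk => hsin _ ?_ ?_
    all_goals
      have hk' : (k : ℝ) + 1 ≤ l := by exact_mod_cast Finset.mem_range.1 hk
      have h0 : (0 : ℝ) ≤ k := Nat.cast_nonneg k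
      rw [hmul]
      push_cast at ht ⊢
      linarith
  have hpos3 : 0 < Real.sin (Real.pi * (D * t - m)) := by
    refine Real.sin_pos_of_pos_of_lt_pi (mul_pos Real.pi_pos (by linarith)) ?_
    nlinarith [Real.pi_pos]
  have hsq : ((-1 : ℝ) ^ m) * (-1) ^ m = 1 := by rw [← mul_pow]; norm_num
  rw [sineProduct, Finset.prod_range_add, hs, hp, mul_assoc ((-1) ^ m) (∏ _ ∈ _, _),
    mul_mul_mul_comm, hsq, one_mul]
  exact mul_pos hpos3 (mul_pos hpos1 hpos2)

theorem sineProduct_nonneg {D b : ℝ} {K : ℕ} {t : ℝ} (hD : 0 < D) (hb : 0 < b)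
    (hbD : b * (K + 1) ≤ D) (ht0 : 0 < t) (ht : D * t < K + 1) : 0 ≤ sineProduct D b K t := by
  by_cases h : ∃ m : ℕ, D * t = m
  · obtain ⟨m, hm⟩ := h
    exact (sineProduct_eq_zero hm).ge
  · exact (sineProduct_pos hD hb hbD ht0 ht (not_exists.1 h)).le

theorem sineProduct_add_shift_pos {D b : ℝ} {K : ℕ} {t δ : ℝ} (hD : 0 < D) (hb : 0 < b)
    (hbD : b * (K + 1) ≤ D) (hδ : 0 < δ) (hδ1 : D * δ < 1) (ht0 : δ < t) (ht : D * t < K + 1) :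
    0 < sineProduct D b K t + sineProduct D b K (t - δ) := by
  have hDδ : 0 < D * δ := mul_pos hD hδ
  have ht' : D * (t - δ) < K + 1 := by linarith [mul_sub D t δ]
  by_cases h : ∃ m : ℕ, D * t = m
  · obtain ⟨m, hm⟩ := h
    rw [sineProduct_eq_zero hm, zero_add]
    refine sineProduct_pos hD hb hbD (by linarith) ht' fun n hn => ?_
    have h1 : (n : ℝ) < m := by linarith [mul_sub D t δ]
    have h2 : (m : ℝ) < (n + 1 : ℕ) := by push_cast; linarith [mul_sub D t δ]
    have h1' : n < m := by exact_mod_cast h1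
    have h2' : m < n + 1 := by exact_mod_cast h2
    omega
  · exact add_pos_of_pos_of_nonneg
      (sineProduct_pos hD hb hbD (hδ.trans ht0) ht (not_exists.1 h))
      (sineProduct_nonneg hD hb hbD (by linarith) ht')

/-- Every trigonometric polynomial with arithmetic progression spectrum is annihilated by a
positive combination of point evaluations at `K + 2` points with spacing `1 / (b * K + 2 * N)`. -/
theorem sum_sineBinom_mul_sum_exp_eq_zero {N K b : ℕ} (hb : 1 ≤ b) (hbN : b < 2 * N)
    {S : Finset ℤ} (hS : ∀ lam : ℤ, lam ∈ S → ∃ j : ℕ, j ≤ K ∧ |lam| = (N : ℤ) + j * b)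
    (c : ℤ → ℂ) (u : ℝ) :
    ∑ k ∈ Finset.range (K + 1 + 1),
      (sineBinom (Real.pi * b / (b * K + 2 * N)) (K + 1) k : ℂ) *
      ∑ lam ∈ S, c lam * Complex.exp (2 * Real.pi * Complex.I * (lam : ℂ) *
        ((u + k / (b * K + 2 * N) : ℝ) : ℂ)) = 0 := by
  have hb' : (0 : ℝ) < b := by exact_mod_cast hb
  have hbN' : (b : ℝ) < 2 * N := by exact_mod_cast hbN
  have hD : (0 : ℝ) < b * K + 2 * N := by
    have : (0 : ℝ) ≤ b * K := by positivity
    linarith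
  have hDc : (b : ℂ) * K + 2 * N ≠ 0 := by exact_mod_cast hD.ne'
  have hθ : 0 < Real.pi * b / (b * K + 2 * N) := by positivity
  have hθ1 : ((K + 1 : ℕ) : ℝ) * (Real.pi * b / (b * K + 2 * N)) < Real.pi := by
    rw [mul_div_assoc', div_lt_iff₀ hD]
    push_cast
    nlinarith [Real.pi_pos]
  simp_rw [Finset.mul_sum]
  rw [Finset.sum_comm]
  refine Finset.sum_eq_zero fun lam hlam => ?_
  have h1 : ∀ k ∈ Finset.range (K + 1 + 1),
      (sineBinom (Real.pi * b / (b * K + 2 * N)) (K + 1) k : ℂ) *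
        (c lam * Complex.exp (2 * Real.pi * Complex.I * (lam : ℂ) *
          ((u + k / (b * K + 2 * N) : ℝ) : ℂ))) =
      c lam * Complex.exp (2 * Real.pi * Complex.I * lam * u) *
        ((sineBinom (Real.pi * b / (b * K + 2 * N)) (K + 1) k : ℂ) *
          Complex.exp (2 * Real.pi * Complex.I * lam / (b * K + 2 * N)) ^ k) := by
    intro k _
    have : Complex.exp (2 * Real.pi * Complex.I * (lam : ℂ) *
          ((u + k / (b * K + 2 * N) : ℝ) : ℂ)) =
        Complex.exp (2 * Real.pi * Complex.I * lam * u) *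
          Complex.exp (2 * Real.pi * Complex.I * lam / (b * K + 2 * N)) ^ k := by
      rw [← Complex.exp_nat_mul, ← Complex.exp_add]
      congr 1; push_cast; ring
    rw [this]; ring
  rw [Finset.sum_congr rfl h1, ← Finset.mul_sum, sum_sineBinom_mul_pow hθ _ hθ1]
  refine mul_eq_zero_of_right _ ?_
  obtain ⟨j, hj, hlj⟩ := hS lam hlam
  have hneg : Complex.exp (-(Real.pi * Complex.I)) = -1 := by
    rw [Complex.exp_neg, Complex.exp_pi_mul_I]; norm_num
  rcases abs_choice lam with h | h
  · rw [h] at hlj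
    refine Finset.prod_eq_zero (Finset.mem_range.2 (by omega : K - j < K + 1)) ?_
    rw [← Complex.exp_add, hlj, add_eq_zero_iff_eq_neg', ← Complex.exp_pi_mul_I]
    congr 1
    push_cast [Nat.cast_sub hj]
    field_simp
    ring
  · have hlj' : lam = -((N : ℤ) + j * b) := by omega
    refine Finset.prod_eq_zero (Finset.mem_range.2 (by omega : j < K + 1)) ?_
    rw [← Complex.exp_add, hlj', add_eq_zero_iff_eq_neg', ← hneg]
    congr 1
    push_cast
    field_simp
    ring

/-- **Theorem 3** (Kozma–Oravecz): for the arithmetic-progression spectrum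
`S = {λ ∈ ℤ : |λ| = N + jb, 0 ≤ j ≤ K}` with `b < 2N`, the supremum of the lengths of
intervals `I ⊆ [0,1]` on which some real trigonometric polynomial with spectrum in `S`
has no zero equals `(K+1)/(bK+2N)`. -/
theorem M_arith_prog_spectrum
    (N K b : ℕ) (hN : 1 ≤ N) (hb : 1 ≤ b) (hbN : b < 2 * N)
    (S : Finset ℤ)
    (hS : ∀ lam : ℤ, lam ∈ S ↔ ∃ j : ℕ, j ≤ K ∧ |lam| = (N : ℤ) + j * b) :
    sSup {r : ℝ | ∃ (c : ℤ → ℂ) (u v : ℝ), 0 ≤ u ∧ u ≤ v ∧ v ≤ 1 ∧ r = v - u ∧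
        (∀ t : ℝ, (∑ lam ∈ S,
          c lam * Complex.exp (2 * Real.pi * Complex.I * (lam : ℂ) * (t : ℂ))).im = 0) ∧
        (∀ t ∈ Set.Icc u v, (∑ lam ∈ S,
          c lam * Complex.exp (2 * Real.pi * Complex.I * (lam : ℂ) * (t : ℂ))) ≠ 0)}
      = ((K : ℝ) + 1) / (b * K + 2 * N) := by
  have hb' : (0 : ℝ) < b := by exact_mod_cast hb
  have hN' : (1 : ℝ) ≤ N := by exact_mod_cast hN
  have hbN' : (b : ℝ) < 2 * N := by exact_mod_cast hbN
  have hb1 : (1 : ℝ) ≤ b := by exact_mod_cast hb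
  have hK : (0 : ℝ) ≤ K := Nat.cast_nonneg K
  obtain ⟨D, hDdef⟩ : ∃ D : ℝ, D = b * K + 2 * N := ⟨_, rfl⟩
  have hD : 0 < D := by rw [hDdef]; positivity
  have hbD : b * (K + 1) < D := by rw [hDdef]; linarith
  have hL1 : ((K : ℝ) + 1) / D ≤ 1 := by
    rw [div_le_one hD]; nlinarith
  have hlow : ∀ w < ((K : ℝ) + 1) / D,
      ∃ r ∈ {r : ℝ | ∃ (c : ℤ → ℂ) (u v : ℝ), 0 ≤ u ∧ u ≤ v ∧ v ≤ 1 ∧ r = v - u ∧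
        (∀ t : ℝ, (∑ lam ∈ S,
          c lam * Complex.exp (2 * Real.pi * Complex.I * (lam : ℂ) * (t : ℂ))).im = 0) ∧
        (∀ t ∈ Set.Icc u v, (∑ lam ∈ S,
          c lam * Complex.exp (2 * Real.pi * Complex.I * (lam : ℂ) * (t : ℂ))) ≠ 0)}, w < r := by
    intro w hw
    obtain ⟨δ, hδ, hδ'⟩ : ∃ δ : ℝ, 0 < δ ∧ δ < min (1 / (3 * D)) ((((K : ℝ) + 1) / D - w) / 3) :=
      exists_between (lt_min (by positivity) (by linarith))
    have hδ1 := hδ'.trans_le (min_le_left _ _)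
    have hδ2 := hδ'.trans_le (min_le_right _ _)
    rw [lt_div_iff₀ (by positivity)] at hδ1
    have hDL : D * (((K : ℝ) + 1) / D) = K + 1 := by field_simp
    have h3 : 3 * δ ≤ ((K : ℝ) + 1) / D := by
      rw [le_div_iff₀ hD]; nlinarith
    obtain ⟨c₁, hc₁⟩ := exists_sum_exp_eq_sin_mul_prod_sin hS 0 fun k => ((k : ℝ) + 1) / D
    obtain ⟨c₂, hc₂⟩ := exists_sum_exp_eq_sin_mul_prod_sin hS (-(Real.pi * D * δ))
      fun k => ((k : ℝ) + 1) / D + δ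
    have hsum : ∀ t : ℝ, (∑ lam ∈ S, (c₁ + c₂) lam *
        Complex.exp (2 * Real.pi * Complex.I * (lam : ℂ) * (t : ℂ))) =
        ((sineProduct D b K t + sineProduct D b K (t - δ) : ℝ) : ℂ) := by
      intro t
      simp only [Pi.add_apply, add_mul, Finset.sum_add_distrib]
      rw [hc₁, hc₂, ← Complex.ofReal_add, ← hDdef, sineProduct, sineProduct, add_zero]
      congr 3
      · congr 1; ring
      · refine Finset.prod_congr rfl fun k _ => ?_
        congr 1; ring
    refine ⟨((K : ℝ) + 1) / D - δ - 2 * δ, ⟨c₁ + c₂, 2 * δ, ((K : ℝ) + 1) / D - δ,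
      by linarith, by linarith, by linarith, rfl, fun t => ?_, fun t ht => ?_⟩, by linarith⟩
    · rw [hsum, Complex.ofReal_im]
    · rw [hsum]
      have ht2 : D * t < K + 1 := by
        rw [← hDL]; exact mul_lt_mul_of_pos_left (by linarith [ht.2]) hD
      exact_mod_cast (sineProduct_add_shift_pos hD hb' hbD.le hδ (by nlinarith)
        (by linarith [ht.1]) ht2).ne'
  rw [← hDdef]
  refine csSup_eq_of_forall_le_of_forall_lt_exists_gt ?_ ?_ hlow
  · obtain ⟨r, hr, -⟩ := hlow _ (sub_one_lt _)
    exact ⟨r, hr⟩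
  · rintro r ⟨c, u, v, hu, huv, hv, rfl, him, hne⟩
    by_contra! hlt
    let F : ℝ → ℂ := fun t => ∑ lam ∈ S,
      c lam * Complex.exp (2 * Real.pi * Complex.I * (lam : ℂ) * (t : ℂ))
    have hcont : Continuous fun t => (F t).re := by fun_prop
    have hzero := congrArg Complex.re (sum_sineBinom_mul_sum_exp_eq_zero hb hbN
      (fun lam => (hS lam).1) c u)
    rw [← hDdef, Complex.re_sum] at hzero
    simp only [Complex.re_ofReal_mul, Complex.zero_re] at hzero
    have hmem : ∀ k ∈ Finset.range (K + 1 + 1), u + k / D ∈ Set.Icc u v := by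
      intro k hk
      have hk' : (k : ℝ) ≤ K + 1 := by
        exact_mod_cast Nat.lt_succ_iff.1 (Finset.mem_range.1 hk)
      have h1 : (k : ℝ) / D ≤ (K + 1) / D := by gcongr
      have h2 : 0 ≤ (k : ℝ) / D := by positivity
      constructor <;> linarith
    have hW : ∀ k ∈ Finset.range (K + 1 + 1), 0 < sineBinom (Real.pi * b / D) (K + 1) k := by
      intro k hk
      refine sineBinom_pos (by positivity) ?_ (Nat.lt_succ_iff.1 (Finset.mem_range.1 hk))
      rw [mul_div_assoc', div_lt_iff₀ hD]
      push_cast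
      nlinarith [Real.pi_pos]
    have hre : ∀ t ∈ Set.Icc u v, (F t).re ≠ 0 := fun t ht h =>
      hne t ht (Complex.ext h (him t))
    have hnonempty : (Finset.range (K + 1 + 1)).Nonempty := Finset.nonempty_range_add_one
    rcases hcont.continuousOn.pos_or_neg_of_ne_zero hre with h | h
    · exact (Finset.sum_pos (fun k hk => mul_pos (hW k hk) (h _ (hmem k hk)))
        hnonempty).ne' hzero
    · exact (Finset.sum_neg (fun k hk => mul_neg_of_pos_of_neg (hW k hk) (h _ (hmem k hk)))
        hnonempty).ne hzero
end

section
/- For every interval I ⊆ [0,1] with length |I| < 1 there exists a constant α > 1 such that for every integer N ≥ 1 there exists a real trigonometric polynomial f whose spectrum is contained in {λ ∈ ℤ : N ≤ |λ| ≤ αN} and which satisfies f(t) > 0 for every t ∈ I. -/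
open Polynomial in
/-- Cesàro means of `-∑ ζ ^ k` have real part close to `1 / 2` on the unit circle away from `1`. -/
theorem exists_polynomial_re_ge_away_from_one {η : ℝ} (hη : 0 < η) :
    ∃ g : ℂ[X], g.eval 0 = 0 ∧ ∀ ζ : ℂ, ‖ζ‖ = 1 → η ≤ ‖1 - ζ‖ → 1 / 4 ≤ (g.eval ζ).re := by
  obtain ⟨n, hn⟩ := exists_nat_gt (8 / η ^ 2)
  have hn0 : (0 : ℝ) < n := lt_trans (by positivity) hn
  have hnC : (n : ℂ) ≠ 0 := by exact_mod_cast hn0.ne'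
  refine ⟨C (-1 / (n : ℂ)) * ∑ m ∈ Finset.range n, ∑ k ∈ Finset.range m, X ^ (k + 1), ?_, ?_⟩
  · simp [eval_finsetSum]
  intro ζ hζ hd
  have hd0 : 0 < ‖1 - ζ‖ := hη.trans_le hd
  have h1 : 1 - ζ ≠ 0 := norm_pos_iff.mp hd0
  have h1' : ζ ≠ 1 := fun h => h1 (by simp [h])
  have hgeom (m : ℕ) : ∑ k ∈ Finset.range m, ζ ^ k = (1 - ζ ^ m) / (1 - ζ) := by
    rw [eq_div_iff h1, geom_sum_mul_neg]
  have hinner (m : ℕ) :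
      ∑ k ∈ Finset.range m, ζ ^ (k + 1) = ζ / (1 - ζ) - ζ / (1 - ζ) * ζ ^ m := by
    simp_rw [pow_succ, ← Finset.sum_mul, hgeom]
    field_simp
  have heval : (C (-1 / (n : ℂ)) * ∑ m ∈ Finset.range n, ∑ k ∈ Finset.range m,
      X ^ (k + 1) : ℂ[X]).eval ζ =
      -(ζ / (1 - ζ)) + ζ * (1 - ζ ^ n) / (n * (1 - ζ) ^ 2) := by
    simp only [eval_mul, eval_C, eval_finsetSum, eval_pow, eval_X, hinner,
      Finset.sum_sub_distrib, ← Finset.mul_sum, hgeom, Finset.sum_const, Finset.card_range,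
      nsmul_eq_mul]
    field_simp
    ring
  have hre : (-(ζ / (1 - ζ))).re = 1 / 2 := by
    have hsq : ζ.re * ζ.re + ζ.im * ζ.im = 1 := by
      have := Complex.normSq_eq_norm_sq ζ
      rw [hζ, Complex.normSq_apply] at this
      linarith
    have hpos : 0 < Complex.normSq (1 - ζ) := Complex.normSq_pos.mpr h1
    rw [Complex.neg_re, Complex.div_re, ← add_div, neg_eq_iff_eq_neg, div_eq_iff hpos.ne',
      Complex.normSq_apply]
    simp
    nlinarith
  have herr : ‖ζ * (1 - ζ ^ n) / (n * (1 - ζ) ^ 2)‖ ≤ 1 / 4 := by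
    have hnum : ‖1 - ζ ^ n‖ ≤ 2 := by
      refine (norm_sub_le _ _).trans ?_
      simp [hζ]
      norm_num
    have hsq : η ^ 2 ≤ ‖1 - ζ‖ ^ 2 := by gcongr
    rw [div_lt_iff₀ (by positivity)] at hn
    rw [norm_div, norm_mul, norm_mul, norm_pow, hζ, Complex.norm_natCast,
      div_le_iff₀ (by positivity)]
    nlinarith
  rw [heval, Complex.add_re, hre]
  have := (abs_le.mp ((Complex.abs_re_le_norm _).trans herr)).1
  linarith

open Polynomial in
/-- On the unit circle away from `1`, polynomials without constant term approximate `1`. -/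
theorem exists_polynomial_near_one_away_from_one {η ε : ℝ} (hη : 0 < η) (hε : 0 < ε) :
    ∃ W : ℂ[X], X ∣ W ∧ ∀ ζ : ℂ, ‖ζ‖ = 1 → η ≤ ‖1 - ζ‖ → ‖1 - W.eval ζ‖ ≤ ε := by
  obtain ⟨g, hg0, hg⟩ := exists_polynomial_re_ge_away_from_one hη
  obtain ⟨B, hB⟩ := (isCompact_sphere (0 : ℂ) 1).exists_bound_of_continuousOn
    g.continuous.continuousOn
  set b : ℝ := max B 1
  have hb : 1 ≤ b := le_max_right _ _
  set δ : ℝ := 1 / (4 * b ^ 2) with hδ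
  have hδ0 : 0 < δ := by positivity
  set s : ℝ := 1 - δ / 4
  have hs0 : 0 ≤ s := by
    have : δ ≤ 1 := by
      rw [hδ, div_le_one (by positivity)]
      nlinarith
    simp only [s]
    linarith
  have hs1 : √s < 1 := by
    rw [Real.sqrt_lt' one_pos]
    simp only [s]
    linarith
  obtain ⟨m, hm⟩ := exists_pow_lt_of_lt_one hε hs1
  refine ⟨1 - (1 - C (δ : ℂ) * g) ^ m, ?_, ?_⟩
  · rw [X_dvd_iff, coeff_zero_eq_eval_zero]
    simp [hg0]
  intro ζ hζ hd
  have hre := hg ζ hζ hd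
  have hgb : ‖g.eval ζ‖ ≤ b := (hB ζ (by simpa using hζ)).trans (le_max_left _ _)
  have hbd : ‖1 - (δ : ℂ) * g.eval ζ‖ ≤ √s := by
    apply Real.le_sqrt_of_sq_le
    rw [← Complex.normSq_eq_norm_sq, Complex.normSq_apply]
    have h2 : (g.eval ζ).re * (g.eval ζ).re + (g.eval ζ).im * (g.eval ζ).im ≤ b ^ 2 := by
      rw [← Complex.normSq_apply, Complex.normSq_eq_norm_sq]
      gcongr
    have h3 : δ * b ^ 2 = 1 / 4 := by
      rw [hδ]
      field_simp
    have h4 : δ ^ 2 * ((g.eval ζ).re * (g.eval ζ).re + (g.eval ζ).im * (g.eval ζ).im)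
        ≤ δ * (1 / 4) := by
      rw [← h3]
      nlinarith [mul_le_mul_of_nonneg_left h2 (sq_nonneg δ)]
    simp [s]
    nlinarith [mul_le_mul_of_nonneg_left hre hδ0.le]
  have : 1 - (1 - (1 - C (δ : ℂ) * g) ^ m).eval ζ = (1 - (δ : ℂ) * g.eval ζ) ^ m := by
    simp
  rw [this, norm_pow]
  exact (pow_le_pow_left₀ (norm_nonneg _) hbd m).trans hm.le

/-- The upper half of the binomial expansion of `(w + (1 - w)) ^ (2 * N)` is close to `1` for `w`
close to `1`. -/
theorem norm_one_sub_upper_binomial_lt {w : ℂ} (hw : ‖1 - w‖ ≤ 1 / 16) {N : ℕ} (hN : 1 ≤ N) :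
    ‖1 - ∑ j ∈ Finset.Ico N (2 * N + 1), w ^ j * (1 - w) ^ (2 * N - j) * ((2 * N).choose j : ℂ)‖
      < 1 := by
  have hsplit := add_pow w (1 - w) (2 * N)
  rw [add_sub_cancel, one_pow, ← Finset.sum_range_add_sum_Ico _ (show N ≤ 2 * N + 1 by omega)]
    at hsplit
  rw [sub_eq_iff_eq_add.mpr hsplit]
  have hw2 : ‖w‖ ≤ 2 := by
    have := norm_sub_le 1 (1 - w)
    rw [sub_sub_cancel, norm_one] at this
    linarith
  calc _ ≤ ∑ j ∈ Finset.range N, (1 / 8 : ℝ) ^ N * ((2 * N).choose j : ℝ) := by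
        refine norm_sum_le_of_le _ fun j hj => ?_
        have hj' := Finset.mem_range.mp hj
        rw [norm_mul, norm_mul, norm_pow, norm_pow, Complex.norm_natCast]
        gcongr
        calc ‖w‖ ^ j * ‖1 - w‖ ^ (2 * N - j) ≤ 2 ^ N * (1 / 16) ^ N := by
              gcongr
              · exact (pow_le_pow_left₀ (norm_nonneg _) hw2 j).trans
                  (pow_le_pow_right₀ (by norm_num) hj'.le)
              · exact (pow_le_pow_left₀ (norm_nonneg _) hw _).trans
                  (pow_le_pow_of_le_one (by norm_num) (by norm_num) (by omega))
          _ = (1 / 8) ^ N := by rw [← mul_pow]; norm_num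
    _ ≤ (1 / 8 : ℝ) ^ N * ∑ j ∈ Finset.range (2 * N + 1), ((2 * N).choose j : ℝ) := by
        rw [← Finset.mul_sum]
        gcongr
        omega
    _ = (1 / 2) ^ N := by
        have := Nat.sum_range_choose (2 * N)
        rw [← Nat.cast_sum, this, pow_mul]
        push_cast
        rw [← mul_pow]
        norm_num
    _ < 1 := pow_lt_one₀ (by norm_num) (by norm_num) (by omega)

open Polynomial in
/-- A polynomial all of whose monomials have degree in `[N, D]` gives, after taking real
parts on the unit circle, a real trigonometric polynomial. -/
theorem exists_real_trigonometric_of_polynomial (P : ℂ[X]) {N D : ℕ} (hN : 1 ≤ N)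
    (hP : X ^ N ∣ P) (hD : P.natDegree ≤ D) :
    ∃ (S : Finset ℤ) (c : ℤ → ℂ), (∀ k ∈ S, (N : ℤ) ≤ |k| ∧ |k| ≤ D) ∧
      ∀ t : ℝ, ∑ k ∈ S, c k * Complex.exp (2 * Real.pi * Complex.I * (k : ℂ) * (t : ℂ)) =
        ((2 * (P.eval (Complex.exp (2 * Real.pi * Complex.I * t))).re : ℝ) : ℂ) := by
  have hlow : ∀ d < N, P.coeff d = 0 := X_pow_dvd_iff.mp hP
  refine ⟨(Finset.Icc N D).image (fun k : ℕ => (k : ℤ)) ∪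
    (Finset.Icc N D).image (fun k : ℕ => -(k : ℤ)),
    fun k => P.coeff k.toNat + (starRingEnd ℂ) (P.coeff (-k).toNat), ?_, fun t => ?_⟩
  · intro k hk
    simp only [Finset.mem_union, Finset.mem_image, Finset.mem_Icc] at hk
    rcases hk with ⟨m, hm, rfl⟩ | ⟨m, hm, rfl⟩ <;> simp <;> omega
  set z := Complex.exp (2 * Real.pi * Complex.I * t) with hz
  have heval : P.eval z = ∑ m ∈ Finset.Icc N D, P.coeff m * z ^ m := by
    rw [eval_eq_sum_range' (Nat.lt_succ_of_le hD)]
    symm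
    apply Finset.sum_subset
    · intro m hm
      simp only [Finset.mem_Icc, Finset.mem_range] at *
      omega
    · intro m hm hm'
      simp only [Finset.mem_Icc, Finset.mem_range] at *
      rw [hlow m (by omega), zero_mul]
  have hc0 : P.coeff 0 = 0 := hlow 0 (by omega)
  have hconj : (starRingEnd ℂ) z = Complex.exp (-(2 * Real.pi * Complex.I * t)) := by
    rw [hz, ← Complex.exp_conj]
    simp [Complex.conj_ofNat]
  have hdisj : Disjoint ((Finset.Icc N D).image (fun k : ℕ => (k : ℤ)))
      ((Finset.Icc N D).image (fun k : ℕ => -(k : ℤ))) := by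
    rw [Finset.disjoint_left]
    intro k hk hk'
    simp only [Finset.mem_image, Finset.mem_Icc] at hk hk'
    omega
  rw [Finset.sum_union hdisj, Finset.sum_image (by intro a _ b _ h; simpa using h),
    Finset.sum_image (by intro a _ b _ h; simpa using h), ← Complex.add_conj, heval, map_sum]
  congr 1
  · refine Finset.sum_congr rfl fun m _ => ?_
    simp only [Int.toNat_natCast, Int.toNat_neg_natCast, hc0, map_zero, add_zero]
    rw [hz, ← Complex.exp_nat_mul]
    congr 2
    push_cast
    ring
  · refine Finset.sum_congr rfl fun m _ => ?_
    simp only [neg_neg, Int.toNat_natCast, Int.toNat_neg_natCast, hc0, zero_add, map_mul, map_pow]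
    rw [hconj, ← Complex.exp_nat_mul]
    congr 2
    push_cast
    ring

/-- An arc of length less than a full turn stays away from the antipode of its midpoint. -/
theorem exists_norm_one_sub_exp_ge {u v : ℝ} (huv : u ≤ v) (hlen : v - u < 1) :
    ∃ c η : ℝ, 0 < η ∧ ∀ t ∈ Set.Icc u v,
      η ≤ ‖1 - Complex.exp (2 * Real.pi * Complex.I * ((t - c : ℝ) : ℂ))‖ := by
  set c : ℝ := (u + v) / 2 + 1 / 2 with hc
  obtain ⟨s, hs, hmin⟩ := isCompact_Icc.exists_isMinOn (Set.nonempty_Icc.mpr huv)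
    (f := fun t : ℝ => ‖1 - Complex.exp (2 * Real.pi * Complex.I * ((t - c : ℝ) : ℂ))‖)
    (by fun_prop)
  refine ⟨c, _, ?_, fun t ht => hmin ht⟩
  rw [norm_pos_iff, sub_ne_zero]
  intro h
  obtain ⟨n, hn⟩ := Complex.exp_eq_one_iff.mp h.symm
  have hne : (2 * Real.pi * Complex.I : ℂ) ≠ 0 := Complex.two_pi_I_ne_zero
  rw [mul_comm (n : ℂ)] at hn
  have hn' : s - c = (n : ℝ) := by exact_mod_cast mul_left_cancel₀ hne hn
  have h1 : (n : ℝ) < 0 := by linarith [hs.2]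
  have h2 : (-1 : ℝ) < n := by linarith [hs.1]
  norm_cast at h1 h2
  omega

/-- Corollary (Kozma–Oravecz): for every interval `I = [u,v] ⊆ [0,1]` of length `< 1`
there is a constant `α > 1` such that for every `N ≥ 1` some real trigonometric
polynomial with spectrum contained in `{λ ∈ ℤ : N ≤ |λ| ≤ αN}` is strictly positive
on `I`. -/
theorem exists_alpha_band_spectrum_pos
    (u v : ℝ) (hu : 0 ≤ u) (huv : u ≤ v) (hv : v ≤ 1) (hlen : v - u < 1) :
    ∃ α : ℝ, 1 < α ∧ ∀ N : ℕ, 1 ≤ N →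
      ∃ (S : Finset ℤ) (c : ℤ → ℂ),
        (∀ lam ∈ S, (N : ℝ) ≤ |(lam : ℝ)| ∧ |(lam : ℝ)| ≤ α * N) ∧
        (∀ t : ℝ, (∑ lam ∈ S,
          c lam * Complex.exp (2 * Real.pi * Complex.I * (lam : ℂ) * (t : ℂ))).im = 0) ∧
        (∀ t ∈ Set.Icc u v, 0 < (∑ lam ∈ S,
          c lam * Complex.exp (2 * Real.pi * Complex.I * (lam : ℂ) * (t : ℂ))).re) := by
  obtain ⟨c, η, hη, hc⟩ := exists_norm_one_sub_exp_ge huv hlen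
  obtain ⟨W, hXW, hW⟩ :=
    exists_polynomial_near_one_away_from_one hη (show (0 : ℝ) < 1 / 16 by norm_num)
  set a : ℂ := Complex.exp (-(2 * Real.pi * Complex.I * c))
  set V : Polynomial ℂ := W.comp (Polynomial.C a * Polynomial.X)
  have hXV : Polynomial.X ∣ V := by
    rw [Polynomial.X_dvd_iff, Polynomial.coeff_zero_eq_eval_zero] at hXW ⊢
    simp [V, Polynomial.eval_comp, hXW]
  have hV : ∀ t ∈ Set.Icc u v,
      ‖1 - V.eval (Complex.exp (2 * Real.pi * Complex.I * t))‖ ≤ 1 / 16 := by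
    intro t ht
    have hrot : a * Complex.exp (2 * Real.pi * Complex.I * t) =
        Complex.exp (2 * Real.pi * Complex.I * ((t - c : ℝ) : ℂ)) := by
      rw [← Complex.exp_add]
      congr 1
      push_cast
      ring
    have hnorm : ‖Complex.exp (2 * Real.pi * Complex.I * ((t - c : ℝ) : ℂ))‖ = 1 := by
      rw [Complex.norm_exp]
      simp
    simpa [V, Polynomial.eval_comp, hrot] using hW _ hnorm (hc t ht)
  set d := V.natDegree + 1
  refine ⟨2 * d, by simp only [d]; push_cast; linarith [V.natDegree.cast_nonneg (α := ℝ)],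
    fun N hN => ?_⟩
  set P : Polynomial ℂ := ∑ j ∈ Finset.Ico N (2 * N + 1),
    V ^ j * (1 - V) ^ (2 * N - j) * ((2 * N).choose j : Polynomial ℂ)
  have hXP : Polynomial.X ^ N ∣ P := by
    refine Finset.dvd_sum fun j hj => ?_
    exact (((pow_dvd_pow _ (Finset.mem_Ico.mp hj).1).trans (pow_dvd_pow_of_dvd hXV j)).mul_right
      _).mul_right _
  have hV1 : (1 - V).natDegree ≤ d := by
    refine (Polynomial.natDegree_sub_le _ _).trans ?_
    simp [d]
  have hdeg : P.natDegree ≤ 2 * N * d := by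
    refine Polynomial.natDegree_sum_le_of_forall_le _ _ fun j hj => ?_
    have hj' := Finset.mem_Ico.mp hj
    calc _ ≤ j * d + (2 * N - j) * d + 0 := by
          refine Polynomial.natDegree_mul_le_of_le (Polynomial.natDegree_mul_le_of_le ?_ ?_)
            (Polynomial.natDegree_natCast _).le
          · exact Polynomial.natDegree_pow_le_of_le j (Nat.le_succ _)
          · exact Polynomial.natDegree_pow_le_of_le _ hV1
      _ = 2 * N * d := by rw [add_zero, ← add_mul]; congr 1; omega
  obtain ⟨S, b, hS, hsum⟩ := exists_real_trigonometric_of_polynomial P hN hXP hdeg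
  refine ⟨S, b, fun k hk => ?_, fun t => ?_, fun t ht => ?_⟩
  · obtain ⟨h1, h2⟩ := hS k hk
    refine ⟨by exact_mod_cast h1, ?_⟩
    calc |(k : ℝ)| ≤ ((2 * N * d : ℕ) : ℝ) := by exact_mod_cast h2
      _ = 2 * d * N := by push_cast; ring
  · rw [hsum, Complex.ofReal_im]
  · rw [hsum, Complex.ofReal_re]
    have hlt := norm_one_sub_upper_binomial_lt (hV t ht) hN
    have heval : P.eval (Complex.exp (2 * Real.pi * Complex.I * t)) =
        ∑ j ∈ Finset.Ico N (2 * N + 1), (V.eval (Complex.exp (2 * Real.pi * Complex.I * t))) ^ j *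
          (1 - V.eval (Complex.exp (2 * Real.pi * Complex.I * t))) ^ (2 * N - j) *
          ((2 * N).choose j : ℂ) := by
      simp [P, Polynomial.eval_finsetSum]
    rw [← heval] at hlt
    have := (le_abs_self _).trans_lt ((Complex.abs_re_le_norm _).trans_lt hlt)
    rw [Complex.sub_re, Complex.one_re] at this
    linarith
end

section
/- For each integer K ≥ 1 let S_K = {λ ∈ ℤ : |λ| = K² + jK for some 0 ≤ j ≤ K}. Then M(S_K) = (K+1)/(3K²) for every K ≥ 1 (so K·M(S_K) → 1/3 as K → ∞), while K·D(S_K) → (log 2)/2 as K → ∞; in particular, the ratio M(S_K)/D(S_K) converges to 2/(3·log 2) ≠ 1, so M(S_K) and D(S_K) are asymptotically different even though both tend to 0. -/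
open scoped BigOperators

/-- `Mgap S` is the supremum of lengths of subintervals of `[0,1]` on which some real
trigonometric polynomial with spectrum contained in `S` has no zero. -/
noncomputable def Mgap (S : Finset ℤ) : ℝ :=
  sSup {r : ℝ | ∃ (c : ℤ → ℂ) (u v : ℝ), 0 ≤ u ∧ u ≤ v ∧ v ≤ 1 ∧ r = v - u ∧
    (∀ t : ℝ, (∑ lam ∈ S,
      c lam * Complex.exp (2 * Real.pi * Complex.I * (lam : ℂ) * (t : ℂ))).im = 0) ∧
    (∀ t ∈ Set.Icc u v, (∑ lam ∈ S,
      c lam * Complex.exp (2 * Real.pi * Complex.I * (lam : ℂ) * (t : ℂ))) ≠ 0)}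

/-- `Dgap S = ∑_{λ ∈ S} 1/(4|λ|)`. -/
noncomputable def Dgap (S : Finset ℤ) : ℝ := ∑ lam ∈ S, 1 / (4 * |(lam : ℝ)|)

open Polynomial in
/-- A monic real polynomial of degree `K + 1` with nonnegative coefficients whose roots are the
numbers `exp (2πi (K + j) / (3K))`, `0 ≤ j ≤ K`. -/
noncomputable def nodePoly (K : ℕ) : ℝ[X] :=
  (X + 1) ^ ((K + 1) % 2) *
    ∏ j ∈ Finset.range ((K + 1) / 2),
      (X ^ 2 + C (-2 * Real.cos (2 * Real.pi * (K + j) / (3 * K))) * X + 1)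

open Polynomial in
lemma coeff_mul_nonneg {p q : ℝ[X]} (hp : ∀ i, 0 ≤ p.coeff i) (hq : ∀ i, 0 ≤ q.coeff i) (i : ℕ) :
    0 ≤ (p * q).coeff i := by
  rw [coeff_mul]
  exact Finset.sum_nonneg fun x _ => mul_nonneg (hp _) (hq _)

open Polynomial in
lemma coeff_one_nonneg (i : ℕ) : 0 ≤ (1 : ℝ[X]).coeff i := by
  rw [coeff_one]; split_ifs <;> norm_num

lemma cos_node_nonpos {K : ℕ} (hK : 1 ≤ K) {j : ℕ} (hj : j ≤ K) :
    Real.cos (2 * Real.pi * (K + j) / (3 * K)) ≤ 0 := by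
  have hK' : (1 : ℝ) ≤ K := by exact_mod_cast hK
  have hj' : (j : ℝ) ≤ K := by exact_mod_cast hj
  have hj0 : (0 : ℝ) ≤ j := j.cast_nonneg
  have hpi := Real.pi_pos
  apply Real.cos_nonpos_of_pi_div_two_le_of_le
  · rw [le_div_iff₀ (by positivity)]
    nlinarith [mul_nonneg hpi.le hj0]
  · rw [div_le_iff₀ (by positivity)]
    nlinarith [mul_le_mul_of_nonneg_left hj' hpi.le]

open Polynomial in
lemma coeff_nodePoly_nonneg {K : ℕ} (hK : 1 ≤ K) (i : ℕ) : 0 ≤ (nodePoly K).coeff i := by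
  refine coeff_mul_nonneg (fun i => ?_) (fun i => ?_) i
  · generalize (K + 1) % 2 = n
    induction n generalizing i with
    | zero => simpa using coeff_one_nonneg i
    | succ n ih =>
      rw [pow_succ]
      refine coeff_mul_nonneg ih (fun i => ?_) i
      rw [coeff_add, coeff_X]
      have := coeff_one_nonneg i
      split_ifs <;> linarith
  · refine Finset.prod_induction _ (fun p : ℝ[X] => ∀ i, 0 ≤ p.coeff i)
      (fun _ _ => coeff_mul_nonneg) coeff_one_nonneg (fun j hj i => ?_) i
    have hc := cos_node_nonpos hK (j := j) (by have := Finset.mem_range.1 hj; omega)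
    rw [coeff_add, coeff_add, coeff_X_pow, coeff_C_mul, coeff_X]
    have := coeff_one_nonneg i
    split_ifs <;> linarith

open Polynomial in
lemma natDegree_quadratic (a : ℝ) : (X ^ 2 + C a * X + 1 : ℝ[X]).natDegree = 2 := by
  compute_degree!

open Polynomial in
lemma monic_quadratic (a : ℝ) : (X ^ 2 + C a * X + 1 : ℝ[X]).Monic := by
  monicity!

open Polynomial in
lemma monic_nodePoly (K : ℕ) : (nodePoly K).Monic :=
  ((monic_X_add_C (1 : ℝ)).pow _).mul (monic_prod_of_monic _ _ fun _ _ => monic_quadratic _)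

open Polynomial in
lemma natDegree_nodePoly (K : ℕ) : (nodePoly K).natDegree = K + 1 := by
  have h1 : (X + 1 : ℝ[X]).Monic := monic_X_add_C 1
  unfold nodePoly
  rw [Monic.natDegree_mul (h1.pow _)
      (monic_prod_of_monic _ _ fun _ _ => monic_quadratic _),
    Monic.natDegree_pow h1,
    natDegree_prod_of_monic _ _ fun _ _ => monic_quadratic _]
  simp only [natDegree_quadratic, Finset.sum_const, Finset.card_range, smul_eq_mul]
  have : (X + 1 : ℝ[X]).natDegree = 1 := natDegree_X_add_C 1
  rw [this]
  omega

lemma exp_quadratic_eq_zero {a φ : ℝ} (h : Real.cos φ = a) :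
    Complex.exp (φ * Complex.I) ^ 2 + ((-2 * a : ℝ) : ℂ) * Complex.exp (φ * Complex.I) + 1 = 0 := by
  subst h
  rw [Complex.exp_mul_I]
  push_cast
  have h1 := Complex.sin_sq_add_cos_sq (φ : ℂ)
  have h2 := Complex.I_sq
  linear_combination (Complex.sin φ) ^ 2 * h2 - h1

lemma exp_eq_neg_one_of_cos {φ : ℝ} (h : Real.cos φ = -1) :
    Complex.exp (φ * Complex.I) = -1 := by
  have hs : Real.sin φ = 0 := by
    have := Real.sin_sq_add_cos_sq φ
    rw [h] at this
    exact pow_eq_zero_iff (two_ne_zero) |>.1 (by linarith)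
  rw [Complex.exp_mul_I, ← Complex.ofReal_cos, ← Complex.ofReal_sin, h, hs]
  simp

open Polynomial in
lemma aeval_nodePoly_eq_zero {K j : ℕ} (hK : 1 ≤ K) (hj : j ≤ K) {φ : ℝ}
    (hφ : Real.cos φ = Real.cos (2 * Real.pi * (K + j) / (3 * K))) :
    aeval (Complex.exp (φ * Complex.I)) (nodePoly K) = 0 := by
  have hK' : (K : ℝ) ≠ 0 := by positivity
  have key : ∀ i < (K + 1) / 2,
      Real.cos φ = Real.cos (2 * Real.pi * (K + i) / (3 * K)) →
      aeval (Complex.exp (φ * Complex.I)) (nodePoly K) = 0 := by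
    intro i hi h
    rw [nodePoly, map_mul, map_prod, Finset.prod_eq_zero (Finset.mem_range.2 hi), mul_zero]
    simpa [Algebra.algebraMap_eq_smul_one] using exp_quadratic_eq_zero h
  rcases lt_trichotomy (2 * j) K with h | h | h
  · exact key j (by omega) hφ
  · have hc : Real.cos φ = -1 := by
      rw [hφ, ← Real.cos_pi]
      congr 1
      have : (K : ℝ) = 2 * j := by exact_mod_cast h.symm
      have hj0 : (j : ℝ) ≠ 0 := by
        intro h0; apply hK'; rw [this, h0]; simp
      rw [this]; field_simp; ring
    have hm : (K + 1) % 2 = 1 := by omega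
    rw [nodePoly, hm, pow_one, map_mul, exp_eq_neg_one_of_cos hc]
    simp
  · refine key (K - j) (by omega) (hφ.trans ?_)
    rw [← Real.cos_two_pi_sub]
    congr 1
    push_cast [hj]
    field_simp
    ring

lemma exp_freq (lam : ℤ) (t : ℝ) :
    Complex.exp (2 * Real.pi * Complex.I * (lam : ℂ) * (t : ℂ)) =
      Complex.exp (((2 * Real.pi * lam * t : ℝ) : ℂ) * Complex.I) := by
  push_cast; congr 1; ring

/-- Sampling a trigonometric polynomial along an arithmetic progression with weights that
annihilate every frequency of the spectrum. -/
lemma sum_coeff_mul_trig_eq_zero {S : Finset ℤ} (c : ℤ → ℂ) (P : Polynomial ℝ) (u h : ℝ)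
    (hP : ∀ lam ∈ S,
      Polynomial.aeval (Complex.exp (((2 * Real.pi * lam * h : ℝ) : ℂ) * Complex.I)) P = 0) :
    ∑ i ∈ Finset.range (P.natDegree + 1), (P.coeff i : ℂ) *
      ∑ lam ∈ S, c lam * Complex.exp (2 * Real.pi * Complex.I * (lam : ℂ) *
        ((u + i * h : ℝ) : ℂ)) = 0 := by
  simp_rw [Finset.mul_sum]
  rw [Finset.sum_comm]
  refine Finset.sum_eq_zero fun lam hlam => ?_
  have h0 := hP lam hlam
  rw [Polynomial.aeval_eq_sum_range] at h0
  rw [← mul_zero (c lam * Complex.exp (2 * Real.pi * Complex.I * (lam : ℂ) * (u : ℂ))), ← h0,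
    Finset.mul_sum]
  refine Finset.sum_congr rfl fun i _ => ?_
  rw [← Complex.exp_nat_mul, Complex.real_smul]
  have : Complex.exp (2 * Real.pi * Complex.I * (lam : ℂ) * ((u + i * h : ℝ) : ℂ)) =
      Complex.exp (2 * Real.pi * Complex.I * (lam : ℂ) * (u : ℂ)) *
        Complex.exp (i * (((2 * Real.pi * lam * h : ℝ) : ℂ) * Complex.I)) := by
    rw [← Complex.exp_add]; congr 1; push_cast; ring
  rw [this]; ring

lemma mul_pos_of_continuous_of_ne_zero {g : ℝ → ℝ} {u v : ℝ} (hg : Continuous g)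
    (hne : ∀ t ∈ Set.Icc u v, g t ≠ 0) {t : ℝ} (ht : t ∈ Set.Icc u v) : 0 < g u * g t := by
  by_contra! hle
  have hu : u ∈ Set.Icc u v := ⟨le_rfl, ht.1.trans ht.2⟩
  have hφ : Continuous fun s => g u * g s := continuous_const.mul hg
  obtain ⟨s, hs, hs0⟩ := intermediate_value_Icc' ht.1 hφ.continuousOn
    ⟨hle, mul_self_nonneg (g u)⟩
  exact (mul_ne_zero (hne u hu) (hne s ⟨hs.1, hs.2.trans ht.2⟩)) hs0

lemma gap_lt {S : Finset ℤ} {K : ℕ} (hK : 1 ≤ K)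
    (hS : ∀ lam ∈ S, ∃ j : ℕ, j ≤ K ∧ |lam| = (K : ℤ) ^ 2 + j * K)
    (c : ℤ → ℂ) {u v : ℝ}
    (him : ∀ t : ℝ, (∑ lam ∈ S,
      c lam * Complex.exp (2 * Real.pi * Complex.I * (lam : ℂ) * (t : ℂ))).im = 0)
    (hne : ∀ t ∈ Set.Icc u v, (∑ lam ∈ S,
      c lam * Complex.exp (2 * Real.pi * Complex.I * (lam : ℂ) * (t : ℂ))) ≠ 0) :
    v - u < ((K : ℝ) + 1) / (3 * K ^ 2) := by
  by_contra! hle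
  have hK0 : (0 : ℝ) < K := by exact_mod_cast hK
  set g : ℝ → ℂ := fun t => ∑ lam ∈ S,
    c lam * Complex.exp (2 * Real.pi * Complex.I * (lam : ℂ) * (t : ℂ)) with hg
  have hcont : Continuous fun t => (g t).re := by
    refine Complex.continuous_re.comp (continuous_finsetSum _ fun lam _ => ?_)
    fun_prop
  have hre : ∀ t ∈ Set.Icc u v, (g t).re ≠ 0 := fun t ht h0 =>
    hne t ht (Complex.ext h0 (him t))
  set h : ℝ := 1 / (3 * K ^ 2) with hh
  have hh0 : 0 < h := by positivity
  have hsum := sum_coeff_mul_trig_eq_zero (S := S) c (nodePoly K) u h (by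
    intro lam hlam
    obtain ⟨j, hj, hlj⟩ := hS lam hlam
    refine aeval_nodePoly_eq_zero hK hj ?_
    have hab : |(lam : ℝ)| = (K : ℝ) ^ 2 + j * K := by exact_mod_cast hlj
    rw [← Real.cos_abs, abs_mul, abs_mul, hab, abs_of_pos hh0, abs_of_pos Real.two_pi_pos, hh]
    congr 1
    field_simp)
  have hsum' : ∑ i ∈ Finset.range (K + 1 + 1),
      (nodePoly K).coeff i * ((g u).re * (g (u + i * h)).re) = 0 := by
    rw [natDegree_nodePoly] at hsum
    have := congrArg Complex.re hsum
    rw [Complex.re_sum] at this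
    simp only [Complex.re_ofReal_mul, Complex.zero_re] at this
    rw [← mul_zero (g u).re, ← this, Finset.mul_sum]
    exact Finset.sum_congr rfl fun i _ => by simp only [hg]; ring
  have hmem : ∀ i ∈ Finset.range (K + 1 + 1), u + i * h ∈ Set.Icc u v := by
    intro i hi
    have hi' : (i : ℝ) ≤ K + 1 := by
      have := Finset.mem_range.1 hi
      exact_mod_cast (by omega : i ≤ K + 1)
    have : (i : ℝ) * h ≤ (K + 1) * h := by gcongr
    have h2 : ((K : ℝ) + 1) * h = (K + 1) / (3 * K ^ 2) := by rw [hh]; ring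
    exact ⟨by nlinarith [mul_nonneg i.cast_nonneg hh0.le], by linarith⟩
  have hpos : 0 < ∑ i ∈ Finset.range (K + 1 + 1),
      (nodePoly K).coeff i * ((g u).re * (g (u + i * h)).re) := by
    refine Finset.sum_pos' (fun i hi => mul_nonneg (coeff_nodePoly_nonneg hK i)
      (mul_pos_of_continuous_of_ne_zero hcont hre (hmem i hi)).le)
      ⟨K + 1, Finset.self_mem_range_succ _, ?_⟩
    have h1 : (nodePoly K).coeff (K + 1) = 1 := by
      have := monic_nodePoly K
      rwa [Polynomial.Monic, Polynomial.leadingCoeff, natDegree_nodePoly] at this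
    rw [h1, one_mul]
    exact mul_pos_of_continuous_of_ne_zero hcont hre (hmem _ (Finset.self_mem_range_succ _))
  exact hpos.ne' hsum'

/-- The complex-valued trigonometric polynomials with spectrum contained in `S`. -/
noncomputable def trigPoly (S : Finset ℤ) : Submodule ℂ (ℝ → ℂ) :=
  Submodule.map
    ({ toFun := fun c t => ∑ lam ∈ S,
        c lam * Complex.exp (2 * Real.pi * Complex.I * (lam : ℂ) * (t : ℂ))
       map_add' := fun c d => by
        funext t; simp [add_mul, Finset.sum_add_distrib]
       map_smul' := fun a c => by
        funext t; simp [Finset.mul_sum, mul_assoc] } : (ℤ → ℂ) →ₗ[ℂ] (ℝ → ℂ)) ⊤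

lemma mem_trigPoly {S : Finset ℤ} {f : ℝ → ℂ} : f ∈ trigPoly S ↔ ∃ c : ℤ → ℂ, ∀ t : ℝ,
    ∑ lam ∈ S, c lam * Complex.exp (2 * Real.pi * Complex.I * (lam : ℂ) * (t : ℂ)) = f t := by
  simp [trigPoly, funext_iff]

lemma exp_mem_trigPoly {S : Finset ℤ} {lam : ℤ} (h : lam ∈ S) :
    (fun t : ℝ => Complex.exp (2 * Real.pi * Complex.I * (lam : ℂ) * (t : ℂ))) ∈ trigPoly S := by
  refine mem_trigPoly.2 ⟨Pi.single lam 1, fun t => ?_⟩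
  rw [Finset.sum_eq_single_of_mem lam h]
  · simp
  · intro b _ hb
    simp [hb]

lemma translate_mem_trigPoly {S : Finset ℤ} {f : ℝ → ℂ} (hf : f ∈ trigPoly S) (a : ℝ) :
    (fun t => f (t + a)) ∈ trigPoly S := by
  obtain ⟨c, hc⟩ := mem_trigPoly.1 hf
  refine mem_trigPoly.2 ⟨fun lam => c lam *
    Complex.exp (2 * Real.pi * Complex.I * (lam : ℂ) * (a : ℂ)), fun t => ?_⟩
  rw [← hc]
  refine Finset.sum_congr rfl fun lam _ => ?_
  rw [mul_assoc, ← Complex.exp_add]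
  congr 2
  push_cast; ring

/-- The extremal function: nonnegative on `[0, (K + 1) / (3K)]`, with zeros only at multiples
of `1 / (3K)` there. -/
noncomputable def extremal (K : ℕ) (x : ℝ) : ℝ :=
  (-1) ^ K * (Real.sin (Real.pi * (3 * K * x)) *
    ∏ j ∈ Finset.range K, Real.sin (Real.pi * (x - (j + 1) / (3 * K))))

lemma neg_one_pow_mul_prod_sin_pos {K i : ℕ} (hi : i ≤ K) {x : ℝ}
    (h1 : (i : ℝ) < 3 * K * x) (h2 : 3 * K * x < i + 1) :
    0 < (-1) ^ K * ((-1) ^ i *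
      ∏ j ∈ Finset.range K, Real.sin (Real.pi * (x - (j + 1) / (3 * K)))) := by
  have hK0 : (0 : ℝ) < K := by
    rcases Nat.eq_zero_or_pos K with rfl | h
    · simp at h1; have : (0 : ℝ) ≤ i := i.cast_nonneg
      linarith
    · exact_mod_cast h
  have hiK : (i : ℝ) ≤ K := by exact_mod_cast hi
  have hK1 : (1 : ℝ) ≤ K := by exact_mod_cast (by exact_mod_cast hK0 : 0 < K)
  have hx : ∀ j : ℕ, x - (j + 1) / (3 * K) = (3 * K * x - (j + 1)) / (3 * K) := by
    intro j; field_simp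
  suffices H : ∀ k, i ≤ k → k ≤ K → 0 < (-1) ^ k * ((-1) ^ i *
      ∏ j ∈ Finset.range k, Real.sin (Real.pi * (x - (j + 1) / (3 * K)))) from H K hi le_rfl
  intro k hk
  induction k, hk using Nat.le_induction with
  | base =>
    intro _
    rw [← mul_assoc, ← mul_pow]
    norm_num
    refine Finset.prod_pos fun j hj => ?_
    have hj' : (j : ℝ) + 1 ≤ i := by exact_mod_cast Finset.mem_range.1 hj
    have hj0 : (0 : ℝ) ≤ j := j.cast_nonneg
    apply Real.sin_pos_of_pos_of_lt_pi
    · apply mul_pos Real.pi_pos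
      rw [hx]
      apply div_pos <;> linarith
    · apply mul_lt_of_lt_one_right Real.pi_pos
      rw [hx, div_lt_one (by positivity)]
      linarith
  | succ k hk ih =>
    intro hkK
    have ih' := ih (by omega)
    have hk' : (i : ℝ) ≤ k := by exact_mod_cast hk
    have hkK' : (k : ℝ) + 1 ≤ K := by exact_mod_cast hkK
    have hi0 : (0 : ℝ) ≤ i := i.cast_nonneg
    have hs : 0 < Real.sin (-(Real.pi * (x - (k + 1) / (3 * K)))) := by
      rw [← mul_neg]
      apply Real.sin_pos_of_pos_of_lt_pi
      · apply mul_pos Real.pi_pos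
        rw [hx, ← neg_div]
        apply div_pos <;> linarith
      · apply mul_lt_of_lt_one_right Real.pi_pos
        rw [hx, ← neg_div, div_lt_one (by positivity)]
        linarith
    rw [Real.sin_neg] at hs
    have := mul_pos ih' hs
    rw [Finset.prod_range_succ, pow_succ]
    linarith

lemma extremal_pos {K i : ℕ} (hi : i ≤ K) {x : ℝ}
    (h1 : (i : ℝ) < 3 * K * x) (h2 : 3 * K * x < i + 1) : 0 < extremal K x := by
  have hp := neg_one_pow_mul_prod_sin_pos hi h1 h2
  have hs : 0 < Real.sin (Real.pi * (3 * K * x - i)) :=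
    Real.sin_pos_of_pos_of_lt_pi (mul_pos Real.pi_pos (by linarith))
      (mul_lt_of_lt_one_right Real.pi_pos (by linarith))
  have h3 : Real.sin (Real.pi * (3 * K * x)) =
      (-1) ^ i * Real.sin (Real.pi * (3 * K * x - i)) := by
    rw [← Real.sin_add_nat_mul_pi]
    congr 1; ring
  rw [extremal, h3]
  have := mul_pos hp hs
  linarith

lemma extremal_eq_zero {K i : ℕ} {x : ℝ} (h : 3 * K * x = i) : extremal K x = 0 := by
  rw [extremal, h, mul_comm Real.pi, Real.sin_nat_mul_pi]
  simp

lemma extremal_nonneg {K : ℕ} {x : ℝ} (h1 : 0 ≤ 3 * K * x) (h2 : 3 * K * x ≤ K + 1) :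
    0 ≤ extremal K x ∧ (extremal K x = 0 → ∃ i : ℕ, 3 * K * x = i) := by
  by_cases h : ∃ i : ℕ, 3 * K * x = i
  · exact ⟨(extremal_eq_zero h.choose_spec).ge, fun _ => h⟩
  · have hfl := Nat.floor_le h1
    have hlt : (⌊3 * K * x⌋₊ : ℝ) < 3 * K * x := lt_of_le_of_ne hfl fun he => h ⟨_, he.symm⟩
    have hK : ⌊3 * K * x⌋₊ ≤ K := by
      have : (⌊3 * K * x⌋₊ : ℝ) < (K + 1 : ℕ) := by push_cast; linarith
      exact Nat.lt_succ_iff.1 (by exact_mod_cast this)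
    have := extremal_pos hK hlt (Nat.lt_floor_add_one _)
    exact ⟨this.le, fun h0 => absurd h0 this.ne'⟩

lemma extremal_add_pos {K : ℕ} {x δ : ℝ} (hx : 0 ≤ 3 * K * x) (hδ : 0 < 3 * K * δ)
    (hδ' : 3 * K * δ < 1) (hx' : 3 * K * (x + δ) ≤ K + 1) :
    0 < extremal K x + extremal K (x + δ) := by
  obtain ⟨p1, z1⟩ := extremal_nonneg hx (by linarith)
  obtain ⟨p2, z2⟩ := extremal_nonneg (by linarith) hx'
  refine lt_of_le_of_ne (add_nonneg p1 p2) fun h0 => ?_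
  obtain ⟨i, hi⟩ := z1 (by linarith)
  obtain ⟨k, hk⟩ := z2 (by linarith)
  have a : (i : ℝ) < k := by linarith
  have b : (k : ℝ) < i + 1 := by linarith
  have a' : i < k := by exact_mod_cast a
  have b' : k < i + 1 := by exact_mod_cast b
  omega

open Polynomial in
lemma prod_sin_eq (K : ℕ) (a : ℕ → ℝ) : ∃ Q : ℂ[X], Q.natDegree ≤ K ∧ ∀ x : ℝ,
    ((∏ j ∈ Finset.range K, Real.sin (Real.pi * (x - a j)) : ℝ) : ℂ) =
      Complex.exp (-(K * (Real.pi * x * Complex.I))) *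
        Q.eval (Complex.exp (2 * (Real.pi * x * Complex.I))) := by
  refine ⟨∏ j ∈ Finset.range K, (C (Complex.I / 2) *
    (C (Complex.exp (Real.pi * a j * Complex.I)) -
      C (Complex.exp (-(Real.pi * a j * Complex.I))) * X)), ?_, fun x => ?_⟩
  · refine (natDegree_prod_le _ _).trans ((Finset.sum_le_card_nsmul _ _ 1 fun j _ => ?_).trans ?_)
    · compute_degree
    · simp
  · rw [eval_prod, ← mul_neg, Complex.exp_nat_mul]
    have hcard (z : ℂ) : z ^ K = ∏ _j ∈ Finset.range K, z := by simp
    rw [hcard, ← Finset.prod_mul_distrib, Complex.ofReal_prod]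
    refine Finset.prod_congr rfl fun j _ => ?_
    simp only [eval_mul, eval_sub, eval_C, eval_X]
    push_cast
    rw [Complex.sin]
    have e1 : Complex.exp (-(Real.pi * (x - a j)) * Complex.I) =
        Complex.exp (-(Real.pi * x * Complex.I)) * Complex.exp (Real.pi * a j * Complex.I) := by
      rw [← Complex.exp_add]; congr 1; ring
    have e2 : Complex.exp (Real.pi * (x - a j) * Complex.I) =
        Complex.exp (-(Real.pi * x * Complex.I)) *
          (Complex.exp (-(Real.pi * a j * Complex.I)) *
            Complex.exp (2 * (Real.pi * x * Complex.I))) := by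
      rw [← Complex.exp_add, ← Complex.exp_add]; congr 1; ring
    rw [e1, e2]; ring

lemma extremal_mem_trigPoly {S : Finset ℤ} {K : ℕ}
    (hS : ∀ lam : ℤ, (∃ j : ℕ, j ≤ K ∧ |lam| = (K : ℤ) ^ 2 + j * K) → lam ∈ S) :
    (fun t : ℝ => (extremal K (K * t) : ℂ)) ∈ trigPoly S := by
  obtain ⟨Q, hQ, hQe⟩ := prod_sin_eq K fun j => (j + 1) / (3 * K)
  have key : (fun t : ℝ => (extremal K (K * t) : ℂ)) =
      ∑ j ∈ Finset.range (K + 1),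
        (((-1) ^ K * (Complex.I / 2) * Q.coeff j) • ((fun t : ℝ => Complex.exp
            (2 * Real.pi * Complex.I * ((-(K ^ 2 + (K - j : ℕ) * K) : ℤ) : ℂ) * (t : ℂ))) -
          fun t : ℝ => Complex.exp
            (2 * Real.pi * Complex.I * ((K ^ 2 + j * K : ℤ) : ℂ) * (t : ℂ)))) := by
    funext t
    rw [extremal, Complex.ofReal_mul, Complex.ofReal_mul, hQe,
      Polynomial.eval_eq_sum_range' (Nat.lt_succ_of_le hQ), Finset.sum_apply, Finset.mul_sum,
      Finset.mul_sum, Finset.mul_sum]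
    refine Finset.sum_congr rfl fun j hj => ?_
    have hjK : j ≤ K := Nat.lt_succ_iff.1 (Finset.mem_range.1 hj)
    simp only [Pi.smul_apply, Pi.sub_apply, smul_eq_mul]
    rw [← Complex.exp_nat_mul]
    push_cast [hjK]
    rw [Complex.sin]
    have e1 : Complex.exp (2 * Real.pi * Complex.I * (-(K ^ 2 + (K - j) * K)) * t) =
        Complex.exp (-(Real.pi * (3 * K * (K * t))) * Complex.I) *
        (Complex.exp (-(K * (Real.pi * (K * t) * Complex.I))) *
          Complex.exp (j * (2 * (Real.pi * (K * t) * Complex.I)))) := by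
      rw [← Complex.exp_add, ← Complex.exp_add]; congr 1; ring
    have e2 : Complex.exp (2 * Real.pi * Complex.I * (K ^ 2 + j * K) * t) =
        Complex.exp (Real.pi * (3 * K * (K * t)) * Complex.I) *
        (Complex.exp (-(K * (Real.pi * (K * t) * Complex.I))) *
          Complex.exp (j * (2 * (Real.pi * (K * t) * Complex.I)))) := by
      rw [← Complex.exp_add, ← Complex.exp_add]; congr 1; ring
    rw [e1, e2]; ring
  rw [key]
  refine Submodule.sum_mem _ fun j hj => Submodule.smul_mem _ _ (Submodule.sub_mem _ ?_ ?_)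
  · refine exp_mem_trigPoly (hS _ ⟨K - j, Nat.sub_le _ _, ?_⟩)
    rw [abs_neg, abs_of_nonneg (by positivity)]
  · refine exp_mem_trigPoly (hS _ ⟨j, Nat.lt_succ_iff.1 (Finset.mem_range.1 hj), ?_⟩)
    rw [abs_of_nonneg (by positivity)]

lemma exists_gap_gt {S : Finset ℤ} {K : ℕ} (hK : 1 ≤ K)
    (hS : ∀ lam : ℤ, (∃ j : ℕ, j ≤ K ∧ |lam| = (K : ℤ) ^ 2 + j * K) → lam ∈ S)
    {w : ℝ} (hw : w < ((K : ℝ) + 1) / (3 * K ^ 2)) :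
    ∃ v : ℝ, w < v ∧ 0 ≤ v ∧ v ≤ 1 ∧ ∃ c : ℤ → ℂ,
      (∀ t : ℝ, (∑ lam ∈ S,
        c lam * Complex.exp (2 * Real.pi * Complex.I * (lam : ℂ) * (t : ℂ))).im = 0) ∧
      (∀ t ∈ Set.Icc 0 v, (∑ lam ∈ S,
        c lam * Complex.exp (2 * Real.pi * Complex.I * (lam : ℂ) * (t : ℂ))) ≠ 0) := by
  have hK1 : (1 : ℝ) ≤ K := by exact_mod_cast hK
  have hK0 : (0 : ℝ) < K := by linarith
  have hK2 : (0 : ℝ) < 3 * K ^ 2 := by positivity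
  obtain ⟨v, hv1, hv2⟩ := exists_between
    (max_lt hw (div_lt_div_of_pos_right (by linarith : (K : ℝ) < K + 1) hK2))
  obtain ⟨hwv, hKv⟩ := max_lt_iff.1 hv1
  rw [div_lt_iff₀ hK2] at hKv
  rw [lt_div_iff₀ hK2] at hv2
  set a : ℝ := ((K : ℝ) + 1) / (3 * K ^ 2) - v with ha
  have hav : 3 * (K : ℝ) ^ 2 * a = K + 1 - v * (3 * K ^ 2) := by
    rw [ha]; field_simp
  have hmem := extremal_mem_trigPoly hS
  obtain ⟨c, hc⟩ := mem_trigPoly.1 (Submodule.add_mem _ hmem (translate_mem_trigPoly hmem a))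
  simp only [Pi.add_apply] at hc
  refine ⟨v, hwv, ?_, ?_, c, fun t => ?_, fun t ht => ?_⟩
  · by_contra! hneg
    nlinarith
  · by_contra! hgt
    nlinarith
  · rw [hc, ← Complex.ofReal_add, Complex.ofReal_im]
  · rw [hc, ← Complex.ofReal_add, Complex.ofReal_ne_zero, mul_add]
    refine (extremal_add_pos ?_ ?_ ?_ ?_).ne'
    · have := ht.1
      positivity
    · linarith
    · linarith
    · nlinarith [mul_le_mul_of_nonneg_right ht.2 hK2.le]

lemma Mgap_eq {S : Finset ℤ} {K : ℕ} (hK : 1 ≤ K)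
    (hS : ∀ lam : ℤ, lam ∈ S ↔ ∃ j : ℕ, j ≤ K ∧ |lam| = (K : ℤ) ^ 2 + j * K) :
    Mgap S = ((K : ℝ) + 1) / (3 * K ^ 2) := by
  refine csSup_eq_of_forall_le_of_forall_lt_exists_gt ?_ ?_ ?_
  · obtain ⟨v, -, h0, h1, c, him, hne⟩ := exists_gap_gt hK (fun lam => (hS lam).2)
      (sub_one_lt _)
    exact ⟨v, c, 0, v, le_rfl, h0, h1, (sub_zero v).symm, him, hne⟩
  · rintro r ⟨c, u, v, -, -, -, rfl, him, hne⟩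
    exact (gap_lt hK (fun lam => (hS lam).1) c him hne).le
  · intro w hw
    obtain ⟨v, hwv, h0, h1, c, him, hne⟩ := exists_gap_gt hK (fun lam => (hS lam).2) hw
    exact ⟨v, ⟨c, 0, v, le_rfl, h0, h1, (sub_zero v).symm, him, hne⟩, hwv⟩

lemma mul_Dgap_eq {S : Finset ℤ} {K : ℕ} (hK : 1 ≤ K)
    (hS : ∀ lam : ℤ, lam ∈ S ↔ ∃ j : ℕ, j ≤ K ∧ |lam| = (K : ℤ) ^ 2 + j * K) :
    (K : ℝ) * Dgap S = (1 / 2) * ∑ j ∈ Finset.range (K + 1), 1 / ((K : ℝ) + j) := by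
  have hK0 : (0 : ℝ) < K := by exact_mod_cast hK
  have hKz : (0 : ℤ) < K := by exact_mod_cast hK
  have hpos : ∀ j : ℕ, (0 : ℤ) < (K : ℤ) ^ 2 + j * K := fun j => by positivity
  have hinj : Function.Injective fun j : ℕ => (K : ℤ) ^ 2 + j * K := by
    intro a b hab
    have := mul_right_cancel₀ hKz.ne' (add_left_cancel hab)
    exact_mod_cast this
  have hSeq : S = (Finset.range (K + 1)).image (fun j : ℕ => (K : ℤ) ^ 2 + j * K) ∪
      (Finset.range (K + 1)).image (fun j : ℕ => -((K : ℤ) ^ 2 + j * K)) := by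
    ext lam
    simp only [hS, Finset.mem_union, Finset.mem_image, Finset.mem_range, Nat.lt_succ_iff]
    constructor
    · rintro ⟨j, hj, h⟩
      rcases abs_eq (hpos j).le |>.1 h with h | h
      · exact Or.inl ⟨j, hj, h.symm⟩
      · exact Or.inr ⟨j, hj, h.symm⟩
    · rintro (⟨j, hj, rfl⟩ | ⟨j, hj, rfl⟩)
      · exact ⟨j, hj, abs_of_pos (hpos j)⟩
      · exact ⟨j, hj, by rw [abs_neg, abs_of_pos (hpos j)]⟩
  have hdisj : Disjoint ((Finset.range (K + 1)).image (fun j : ℕ => (K : ℤ) ^ 2 + j * K))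
      ((Finset.range (K + 1)).image (fun j : ℕ => -((K : ℤ) ^ 2 + j * K))) := by
    rw [Finset.disjoint_left]
    intro lam h1 h2
    obtain ⟨i, -, rfl⟩ := Finset.mem_image.1 h1
    obtain ⟨j, -, h⟩ := Finset.mem_image.1 h2
    have := hpos i
    have := hpos j
    omega
  rw [Dgap, hSeq, Finset.sum_union hdisj, Finset.sum_image hinj.injOn,
    Finset.sum_image fun a _ b _ h => hinj (neg_injective h), ← Finset.sum_add_distrib, Finset.mul_sum,
    Finset.mul_sum]
  refine Finset.sum_congr rfl fun j _ => ?_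
  have hp : (0 : ℝ) < (K : ℝ) ^ 2 + j * K := by exact_mod_cast hpos j
  have hj0 : (0 : ℝ) ≤ j := j.cast_nonneg
  have hp' : (0 : ℝ) < (K : ℝ) + j := by positivity
  push_cast
  rw [abs_neg, abs_of_pos hp]
  field_simp
  ring

lemma sum_range_one_div_add (K n : ℕ) :
    ∑ j ∈ Finset.range n, 1 / ((K : ℝ) + (j + 1)) = harmonic (K + n) - harmonic K := by
  induction n with
  | zero => simp
  | succ n ih =>
    rw [Finset.sum_range_succ, ih, ← add_assoc K n 1, harmonic_succ]
    push_cast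
    rw [one_div]
    ring

open Filter in
lemma tendsto_sum_one_div_add :
    Tendsto (fun K : ℕ => ∑ j ∈ Finset.range (K + 1), 1 / ((K : ℝ) + j)) atTop
      (nhds (Real.log 2)) := by
  have h1 := Real.tendsto_harmonic_sub_log
  have h2 := h1.comp (tendsto_id.const_mul_atTop' (two_pos : 0 < 2))
  have h3 := ((h2.sub h1).add_const (Real.log 2)).add (tendsto_one_div_atTop_nhds_zero_nat (𝕜 := ℝ))
  rw [sub_self, zero_add, add_zero] at h3
  refine h3.congr' ?_
  filter_upwards [eventually_ge_atTop 1] with K hK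
  have hK0 : (K : ℝ) ≠ 0 := by positivity
  rw [Finset.sum_range_succ']
  push_cast
  rw [sum_range_one_div_add, ← two_mul]
  simp only [Function.comp, id]
  push_cast
  rw [Real.log_mul two_ne_zero hK0, add_zero]
  ring

/-- Corollary (Kozma–Oravecz): for `S_K = {λ ∈ ℤ : |λ| = K² + jK, 0 ≤ j ≤ K}` one has
`M(S_K) = (K+1)/(3K²)`, so `K·M(S_K) → 1/3`, while `K·D(S_K) → (log 2)/2`; hence
`M(S_K)/D(S_K) → 2/(3 log 2) ≠ 1`: `M` and `D` are asymptotically different even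
though both tend to `0`. -/
theorem M_and_D_differ
    (S : ℕ → Finset ℤ)
    (hS : ∀ K : ℕ, 1 ≤ K → ∀ lam : ℤ, lam ∈ S K ↔
      ∃ j : ℕ, j ≤ K ∧ |lam| = (K : ℤ) ^ 2 + j * K) :
    (∀ K : ℕ, 1 ≤ K → Mgap (S K) = ((K : ℝ) + 1) / (3 * K ^ 2)) ∧
    Filter.Tendsto (fun K : ℕ => (K : ℝ) * Mgap (S K)) Filter.atTop (nhds (1 / 3)) ∧
    Filter.Tendsto (fun K : ℕ => (K : ℝ) * Dgap (S K)) Filter.atTop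
      (nhds (Real.log 2 / 2)) ∧
    Filter.Tendsto (fun K : ℕ => Mgap (S K) / Dgap (S K)) Filter.atTop
      (nhds (2 / (3 * Real.log 2))) := by
  have hM : ∀ K : ℕ, 1 ≤ K → Mgap (S K) = ((K : ℝ) + 1) / (3 * K ^ 2) :=
    fun K hK => Mgap_eq hK (hS K hK)
  have hKM : Filter.Tendsto (fun K : ℕ => (K : ℝ) * Mgap (S K)) Filter.atTop (nhds (1 / 3)) := by
    have h := (tendsto_one_div_atTop_nhds_zero_nat (𝕜 := ℝ)).const_add 1 |>.const_mul (1 / 3)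
    rw [add_zero, mul_one] at h
    refine h.congr' ?_
    filter_upwards [Filter.eventually_ge_atTop 1] with K hK
    have hK0 : (K : ℝ) ≠ 0 := by positivity
    rw [hM K hK]
    field_simp
  have hKD : Filter.Tendsto (fun K : ℕ => (K : ℝ) * Dgap (S K)) Filter.atTop
      (nhds (Real.log 2 / 2)) := by
    have h := tendsto_sum_one_div_add.const_mul (1 / 2)
    rw [one_div_mul_eq_div] at h
    refine h.congr' ?_
    filter_upwards [Filter.eventually_ge_atTop 1] with K hK
    exact (mul_Dgap_eq hK (hS K hK)).symm
  refine ⟨hM, hKM, hKD, ?_⟩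
  have hlog : Real.log 2 ≠ 0 := (Real.log_pos one_lt_two).ne'
  have h := hKM.div hKD (by simpa using hlog)
  have he : (1 : ℝ) / 3 / (Real.log 2 / 2) = 2 / (3 * Real.log 2) := by field_simp
  rw [he] at h
  refine h.congr' ?_
  filter_upwards [Filter.eventually_ge_atTop 1] with K hK
  have hK0 : (K : ℝ) ≠ 0 := by positivity
  exact mul_div_mul_left _ _ hK0
end
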